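/- Let X be a finite (q+1)-regular graph on n vertices satisfying the Sarnak-Xue density property with parameter A ∈ (0,1]: for every p > 2 and ε > 0, #{i : p_i ≥ p} ≪_ε n^{1−A(1−2/p)+ε}. Then for every k ≤ 2A·log_q(n) and every ε > 0, the number P(X,k) of closed non-backtracking paths of length k in X satisfies P(X,k) ≪_ε n^{1+ε}·q^{k/2}. -/

import Mathlib

open scoped Classical

/-- Number of non-backtracking paths of length `k` from `x` to `y` in `G`. -/
noncomputable def nbCount {V : Type*} [Fintype V] (G : SimpleGraph V) (k : ℕ)
    (x y : V) : ℕ :=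
  (Finset.univ.filter (fun w : Fin (k + 1) → V =>
    w 0 = x ∧ w (Fin.last k) = y ∧
    (∀ i : Fin k, G.Adj (w i.castSucc) (w i.succ)) ∧
    (∀ i j : Fin (k + 1), (j : ℕ) = (i : ℕ) + 2 → w j ≠ w i))).card

/-- `P(X,k)`: the number of closed non-backtracking paths of length `k` in `G`. -/
noncomputable def PX {V : Type*} [Fintype V] (G : SimpleGraph V) (k : ℕ) : ℕ :=
  ∑ x, nbCount G k x x

/-- The reciprocal `1/p` of the `p`-value of a normalized adjacency eigenvalue. -/
noncomputable def pexp (q : ℕ) (lam : ℝ) : ℝ :=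
  if |lam| ≤ 2 * Real.sqrt q / ((q : ℝ) + 1) then 1 / 2
  else 1 - Real.logb q
    ((((q : ℝ) + 1) * |lam| + Real.sqrt (((q : ℝ) + 1) ^ 2 * lam ^ 2 - 4 * q)) / 2)

/-- A tuple of vertices that is a non-backtracking path in `G`. -/
def IsNonBacktracking {V : Type*} (G : SimpleGraph V) {k : ℕ} (w : Fin (k + 1) → V) : Prop :=
  (∀ i : Fin k, G.Adj (w i.castSucc) (w i.succ)) ∧
    ∀ i j : Fin (k + 1), (j : ℕ) = (i : ℕ) + 2 → w j ≠ w i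

theorem isNonBacktracking_cons {V : Type*} {G : SimpleGraph V} {k : ℕ} {x : V}
    {w : Fin (k + 2) → V} :
    IsNonBacktracking G (Fin.cons x w : Fin (k + 3) → V) ↔
      G.Adj x (w 0) ∧ w 1 ≠ x ∧ IsNonBacktracking G w := by
  constructor
  · rintro ⟨hadj, hnb⟩
    refine ⟨by simpa using hadj 0, ?_, fun i => ?_, fun i j hij => ?_⟩
    · exact hnb 0 (Fin.succ 1) rfl
    · simpa [← Fin.succ_castSucc] using hadj i.succ
    · simpa using hnb i.succ j.succ (by simp; omega)
  · rintro ⟨h0, h1, hadj, hnb⟩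
    refine ⟨fun i => ?_, fun i j hij => ?_⟩
    · cases i using Fin.cases with
      | zero => simpa using h0
      | succ i => simpa [← Fin.succ_castSucc] using hadj i
    · cases j using Fin.cases with
      | zero => simp at hij
      | succ j =>
        cases i using Fin.cases with
        | zero =>
          have hj : j = 1 := by
            ext
            simpa using hij
          rw [hj, Fin.cons_succ]
          exact h1
        | succ i => simpa using hnb i j (by simpa using hij)

/-- Number of non-backtracking paths of length `k + 1` from `x` to `y` in `G` whose first step goes
to `z`, by recursion on the length. -/
noncomputable def nbStepCount {V : Type*} [Fintype V] (G : SimpleGraph V) : ℕ → V → V → V → ℕ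
  | 0, x, z, y => if G.Adj x z ∧ z = y then 1 else 0
  | k + 1, x, z, y =>
    if G.Adj x z then ∑ u ∈ Finset.univ.filter (· ≠ x), nbStepCount G k z u y else 0

theorem card_nonBacktracking_eq_nbStepCount {V : Type*} [Fintype V] (G : SimpleGraph V) (k : ℕ)
    (x z y : V) :
    (Finset.univ.filter (fun w : Fin (k + 2) → V =>
      w 0 = x ∧ w 1 = z ∧ w (Fin.last (k + 1)) = y ∧ IsNonBacktracking G w)).card =
      nbStepCount G k x z y := by
  induction k generalizing x z y with
  | zero =>
    rw [nbStepCount]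
    split_ifs with h
    · obtain ⟨h, rfl⟩ := h
      rw [Finset.card_eq_one]
      refine ⟨![x, z], ?_⟩
      ext w
      simp only [Finset.mem_filter, Finset.mem_univ, true_and, Finset.mem_singleton]
      constructor
      · rintro ⟨h0, h1, -⟩
        ext i
        fin_cases i
        · exact h0
        · exact h1
      · rintro rfl
        refine ⟨rfl, rfl, rfl, fun i => ?_, fun i j hij => ?_⟩
        · fin_cases i
          exact h
        · omega
    · rw [Finset.card_eq_zero, Finset.filter_eq_empty_iff]
      rintro w - ⟨rfl, rfl, h2, h3, -⟩
      exact h ⟨h3 0, h2⟩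
  | succ k ih =>
    rw [nbStepCount]
    split_ifs with h
    · have hcard : (Finset.univ.filter (fun w : Fin (k + 3) → V =>
          w 0 = x ∧ w 1 = z ∧ w (Fin.last (k + 2)) = y ∧ IsNonBacktracking G w)).card =
          (Finset.univ.filter (fun w : Fin (k + 2) → V =>
            w 0 = z ∧ w 1 ≠ x ∧ w (Fin.last (k + 1)) = y ∧ IsNonBacktracking G w)).card := by
        symm
        refine Finset.card_bij (fun w _ => Fin.cons x w) ?_ ?_ ?_
        · intro w hw
          simp only [Finset.mem_filter, Finset.mem_univ, true_and] at hw ⊢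
          obtain ⟨rfl, h1, h2, h3⟩ := hw
          exact ⟨rfl, rfl, by simpa using h2, isNonBacktracking_cons.2 ⟨h, h1, h3⟩⟩
        · intro w _ w' _ hww
          exact Fin.cons_right_injective (α := fun _ => V) x hww
        · intro w hw
          simp only [Finset.mem_filter, Finset.mem_univ, true_and] at hw
          obtain ⟨x', w, rfl⟩ := Fin.exists_cons w
          obtain ⟨h0, h1, h2, h3⟩ := hw
          rw [isNonBacktracking_cons] at h3
          obtain rfl : x' = x := h0
          refine ⟨w, ?_, rfl⟩
          simp only [Finset.mem_filter, Finset.mem_univ, true_and]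
          exact ⟨h1, h3.2.1, by simpa using h2, h3.2.2⟩
      rw [hcard, Finset.card_eq_sum_card_fiberwise (f := fun w => w 1)
        (t := Finset.univ.filter (· ≠ x))]
      · refine Finset.sum_congr rfl fun u hu => ?_
        rw [← ih, Finset.filter_filter]
        congr 1
        ext w
        simp only [Finset.mem_filter, Finset.mem_univ, true_and] at hu ⊢
        constructor
        · rintro ⟨⟨h0, -, h2, h3⟩, h1⟩
          exact ⟨h0, h1, h2, h3⟩
        · rintro ⟨h0, h1, h2, h3⟩
          exact ⟨⟨h0, h1 ▸ hu, h2, h3⟩, h1⟩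
      · intro w hw
        simp only [Finset.coe_filter, Finset.mem_univ, true_and, Set.mem_ofPred_eq] at hw ⊢
        exact hw.2.1
    · rw [Finset.card_eq_zero, Finset.filter_eq_empty_iff]
      rintro w - ⟨rfl, rfl, -, h3, -⟩
      exact h (h3 0)

theorem nbCount_succ_eq_sum_nbStepCount {V : Type*} [Fintype V] (G : SimpleGraph V) (k : ℕ)
    (x y : V) : nbCount G (k + 1) x y = ∑ z, nbStepCount G k x z y := by
  rw [nbCount, Finset.card_eq_sum_card_fiberwise (f := fun w => w 1) (t := Finset.univ)
    (fun _ _ => by simp)]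
  refine Finset.sum_congr rfl fun z _ => ?_
  rw [← card_nonBacktracking_eq_nbStepCount, Finset.filter_filter]
  congr 1
  ext w
  simp only [Finset.mem_filter, Finset.mem_univ, true_and]
  unfold IsNonBacktracking
  tauto

/-- The matrix counting non-backtracking paths of length `k`. -/
noncomputable def nbMatrix {V : Type*} [Fintype V] (G : SimpleGraph V) (k : ℕ) : Matrix V V ℝ :=
  Matrix.of fun x y => (nbCount G k x y : ℝ)

theorem nbMatrix_one {V : Type*} [Fintype V] (G : SimpleGraph V) :
    nbMatrix G 1 = G.adjMatrix ℝ := by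
  ext x y
  simp only [nbMatrix, Matrix.of_apply, nbCount_succ_eq_sum_nbStepCount, nbStepCount,
    SimpleGraph.adjMatrix_apply]
  rw [Finset.sum_eq_single y]
  · simp
  · intro z _ hz
    simp [hz]
  · simp

theorem adjMatrix_mul_nbMatrix_apply {V : Type*} [Fintype V] (G : SimpleGraph V) (k : ℕ)
    (x y : V) :
    (G.adjMatrix ℝ * nbMatrix G (k + 1)) x y = nbMatrix G (k + 2) x y +
      ∑ z, if G.Adj x z then (nbStepCount G k z x y : ℝ) else 0 := by
  simp only [Matrix.mul_apply, nbMatrix, Matrix.of_apply, nbCount_succ_eq_sum_nbStepCount,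
    SimpleGraph.adjMatrix_apply, nbStepCount]
  push_cast
  rw [← Finset.sum_add_distrib]
  refine Finset.sum_congr rfl fun z _ => ?_
  split_ifs with h
  · rw [one_mul, ← Finset.sum_filter_add_sum_filter_not Finset.univ (· ≠ x)]
    simp [Finset.sum_filter]
  · simp

theorem nbMatrix_two {V : Type*} [Fintype V] {G : SimpleGraph V} {q : ℕ}
    (hreg : G.IsRegularOfDegree (q + 1)) :
    nbMatrix G 2 = G.adjMatrix ℝ * nbMatrix G 1 - ((q : ℝ) + 1) • (1 : Matrix V V ℝ) := by
  ext x y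
  have hdeg := hreg x
  rw [Matrix.sub_apply, adjMatrix_mul_nbMatrix_apply]
  have : (∑ z, if G.Adj x z then (nbStepCount G 0 z x y : ℝ) else 0) =
      ((q : ℝ) + 1) * if x = y then 1 else 0 := by
    rw [← Finset.sum_filter, ← SimpleGraph.neighborFinset_eq_filter,
      Finset.sum_congr rfl (g := fun _ => if x = y then (1 : ℝ) else 0), Finset.sum_const,
      SimpleGraph.card_neighborFinset_eq_degree, hdeg]
    · simp
    · intro z hz
      rw [SimpleGraph.mem_neighborFinset] at hz
      simp [nbStepCount, hz.symm]
  rw [this]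
  simp [Matrix.one_apply]

theorem nbMatrix_add_three {V : Type*} [Fintype V] {G : SimpleGraph V} {q : ℕ}
    (hreg : G.IsRegularOfDegree (q + 1)) (k : ℕ) :
    nbMatrix G (k + 3) = G.adjMatrix ℝ * nbMatrix G (k + 2) - (q : ℝ) • nbMatrix G (k + 1) := by
  ext x y
  rw [Matrix.sub_apply, adjMatrix_mul_nbMatrix_apply]
  have hzero : ∀ u, ¬ G.Adj x u → nbStepCount G k x u y = 0 := by
    intro u hu
    cases k <;> simp [nbStepCount, hu]
  have : (∑ z, if G.Adj x z then (nbStepCount G (k + 1) z x y : ℝ) else 0) =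
      (q : ℝ) * nbMatrix G (k + 1) x y := by
    calc (∑ z, if G.Adj x z then (nbStepCount G (k + 1) z x y : ℝ) else 0)
        = ∑ z, ∑ u, if G.Adj x z ∧ u ≠ z then (nbStepCount G k x u y : ℝ) else 0 := by
          refine Finset.sum_congr rfl fun z _ => ?_
          by_cases h : G.Adj x z
          · simp [nbStepCount, h, h.symm, Finset.sum_filter]
          · simp [h]
      _ = ∑ u, (q : ℝ) * nbStepCount G k x u y := by
          rw [Finset.sum_comm]
          refine Finset.sum_congr rfl fun u _ => ?_
          by_cases h : G.Adj x u
          · rw [← Finset.sum_filter, Finset.sum_const, nsmul_eq_mul]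
            congr 2
            have : Finset.univ.filter (fun z => G.Adj x z ∧ u ≠ z) =
                (G.neighborFinset x).erase u := by
              ext z
              simp [and_comm, eq_comm]
            rw [this, Finset.card_erase_of_mem (by simpa using h),
              SimpleGraph.card_neighborFinset_eq_degree, hreg x, Nat.add_sub_cancel]
          · simp [hzero u h]
      _ = (q : ℝ) * nbMatrix G (k + 1) x y := by
          simp [nbMatrix, nbCount_succ_eq_sum_nbStepCount, Finset.mul_sum]
  rw [this]
  simp

theorem PX_eq_trace {V : Type*} [Fintype V] (G : SimpleGraph V) (k : ℕ) :
    (PX G k : ℝ) = (nbMatrix G k).trace := by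
  simp [PX, nbMatrix, Matrix.trace]

/-- The polynomial `f` such that `f` of the adjacency matrix of a `(q + 1)`-regular graph counts
the non-backtracking paths of length `k + 1`. -/
noncomputable def nbPoly (q : ℕ) : ℕ → Polynomial ℝ
  | 0 => Polynomial.X
  | 1 => Polynomial.X * Polynomial.X - Polynomial.C ((q : ℝ) + 1)
  | k + 2 => Polynomial.X * nbPoly q (k + 1) - Polynomial.C (q : ℝ) * nbPoly q k

theorem nbMatrix_succ_eq_aeval {V : Type*} [Fintype V] {G : SimpleGraph V} {q : ℕ}
    (hreg : G.IsRegularOfDegree (q + 1)) (k : ℕ) :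
    nbMatrix G (k + 1) = Polynomial.aeval (G.adjMatrix ℝ) (nbPoly q k) := by
  induction k using Nat.twoStepInduction with
  | zero => simp [nbPoly, nbMatrix_one]
  | one =>
    rw [nbMatrix_two hreg, nbMatrix_one]
    simp [nbPoly, Algebra.smul_def]
  | more k ih0 ih1 =>
    rw [nbMatrix_add_three hreg, ih0, ih1]
    simp [nbPoly, Algebra.smul_def]

theorem Matrix.IsHermitian.trace_aeval {n : Type*} [Fintype n] [DecidableEq n]
    {M : Matrix n n ℝ} (hM : M.IsHermitian) (p : Polynomial ℝ) :
    (Polynomial.aeval M p).trace = ∑ i, p.eval (hM.eigenvalues i) := by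
  have h := congrArg (fun N => (Polynomial.aeval N p).trace) hM.spectral_theorem
  refine h.trans ?_
  have hd : Polynomial.aeval (Matrix.diagonal hM.eigenvalues) p =
      Matrix.diagonal fun i => p.eval (hM.eigenvalues i) := by
    have := Polynomial.aeval_algHom_apply (Matrix.diagonalAlgHom ℝ (n := n) (α := ℝ))
      hM.eigenvalues p
    simp only [Matrix.diagonalAlgHom_apply] at this
    rw [this]
    congr 1
    ext i
    simp
  have hconj := Polynomial.aeval_algHom_apply
    (Unitary.conjStarAlgAut ℝ _ hM.eigenvectorUnitary).toAlgEquiv.toAlgHom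
    (Matrix.diagonal hM.eigenvalues) p
  refine (congrArg Matrix.trace hconj).trans ?_
  rw [hd]
  refine (congrArg Matrix.trace
    (Unitary.conjStarAlgAut_apply (S := ℝ) hM.eigenvectorUnitary _)).trans ?_
  rw [Matrix.trace_mul_comm, ← mul_assoc]
  simp [Matrix.trace]

theorem trace_aeval_eq_sum_of_charpoly {n ι : Type*} [Fintype n] [DecidableEq n] [Fintype ι]
    {M : Matrix n n ℝ} (hM : M.IsHermitian) {μ : ι → ℝ}
    (hμ : M.charpoly = ∏ i, (Polynomial.X - Polynomial.C (μ i))) (p : Polynomial ℝ) :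
    (Polynomial.aeval M p).trace = ∑ i, p.eval (μ i) := by
  have hroots : Finset.univ.val.map μ = Finset.univ.val.map hM.eigenvalues := by
    have hprod : M.charpoly =
        ((Finset.univ.val.map μ).map fun a => Polynomial.X - Polynomial.C a).prod := by
      rw [hμ, Multiset.map_map]
      rfl
    have h := hM.roots_charpoly_eq_eigenvalues
    rw [hprod, Polynomial.roots_multiset_prod_X_sub_C] at h
    exact h
  rw [hM.trace_aeval]
  have h := congrArg (fun s => (s.map fun x => p.eval x).sum) hroots
  simp only [Multiset.map_map] at h
  exact h.symm

theorem abs_le_of_charpoly_adjMatrix {V ι : Type*} [Fintype V] [Fintype ι] {G : SimpleGraph V}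
    {d : ℕ} (hreg : G.IsRegularOfDegree d) {μ : ι → ℝ}
    (hμ : (G.adjMatrix ℝ).charpoly = ∏ i, (Polynomial.X - Polynomial.C (μ i))) (i : ι) :
    |μ i| ≤ d := by
  have heig : Module.End.HasEigenvalue (Matrix.toLin' (G.adjMatrix ℝ)) (μ i) := by
    rw [Module.End.hasEigenvalue_iff_isRoot_charpoly, Matrix.charpoly_toLin', hμ,
      Polynomial.IsRoot, Polynomial.eval_prod]
    exact Finset.prod_eq_zero (Finset.mem_univ i) (by simp)
  obtain ⟨x, hx⟩ := eigenvalue_mem_ball heig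
  rw [Metric.mem_closedBall, Real.dist_eq, SimpleGraph.adjMatrix_apply,
    if_neg (G.loopless.irrefl x), sub_zero] at hx
  refine hx.trans ?_
  calc ∑ y ∈ Finset.univ.erase x, ‖G.adjMatrix ℝ x y‖
      ≤ ∑ y, ‖G.adjMatrix ℝ x y‖ :=
        Finset.sum_le_sum_of_subset_of_nonneg (Finset.erase_subset _ _) fun _ _ _ => norm_nonneg _
    _ = d := by
        rw [← hreg x, ← SimpleGraph.card_neighborFinset_eq_degree,
          SimpleGraph.neighborFinset_eq_filter, Finset.card_filter]
        push_cast
        refine Finset.sum_congr rfl fun y _ => ?_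
        rw [SimpleGraph.adjMatrix_apply]
        split_ifs <;> simp

theorem abs_eval_nbPoly_le {q : ℕ} {μ θ : ℝ} (hθ : 1 ≤ θ) {α β : ℂ} (hadd : α + β = μ)
    (hmul : α * β = q) (hα : ‖α‖ ≤ θ) (hβ : ‖β‖ ≤ θ) (k : ℕ) :
    |(nbPoly q k).eval μ| ≤ 2 * (k + 2) * θ ^ (k + 1) := by
  set t : ℕ → ℂ := fun k => ∑ i ∈ Finset.range k, α ^ i * β ^ (k - 1 - i) with ht
  have hsucc : ∀ k, t (k + 1) = α ^ k + β * t k := fun k => geom_sum₂_succ_eq α β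
  have hrec : ∀ k, t (k + 2) = μ * t (k + 1) - q * t k := by
    intro k
    rw [hsucc (k + 1), hsucc k, ← hadd, ← hmul]
    ring
  have h0 : t 0 = 0 := by simp [ht]
  have h1 : t 1 = 1 := by simp [ht]
  have heval : ∀ k, (((nbPoly q k).eval μ : ℝ) : ℂ) = t (k + 2) - t k := by
    intro k
    induction k using Nat.twoStepInduction with
    | zero => simp [nbPoly, hrec, h0, h1]
    | one =>
      simp [nbPoly, hrec, h0, h1]
      ring
    | more k ih0 ih1 =>
      simp only [nbPoly, Polynomial.eval_sub, Polynomial.eval_mul, Polynomial.eval_X,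
        Polynomial.eval_C]
      push_cast
      rw [ih0, ih1, hrec (k + 2), hrec k]
      ring
  have hbound : ∀ k : ℕ, ‖t (k + 1)‖ ≤ (k + 1) * θ ^ k := by
    intro k
    induction k with
    | zero => simp [h1]
    | succ k ih =>
      have hpow : ‖α ^ (k + 1)‖ ≤ θ ^ (k + 1) := by
        rw [norm_pow]
        gcongr
      have hprod : ‖β * t (k + 1)‖ ≤ θ * ((k + 1) * θ ^ k) := by
        rw [norm_mul]
        gcongr
      rw [hsucc]
      refine (norm_add_le _ _).trans ((add_le_add hpow hprod).trans (le_of_eq ?_))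
      push_cast
      ring
  have hsmall : ‖t k‖ ≤ (k + 2) * θ ^ (k + 1) := by
    cases k with
    | zero =>
      rw [h0, norm_zero]
      positivity
    | succ k =>
      refine (hbound k).trans (mul_le_mul ?_ (pow_le_pow_right₀ hθ (by omega)) (by positivity)
        (by positivity))
      push_cast
      linarith
  have hlarge := hbound (k + 1)
  push_cast at hlarge
  rw [← Real.norm_eq_abs, ← Complex.norm_real, heval]
  refine (norm_sub_le _ _).trans ?_
  linarith

theorem rpow_one_sub_pexp_of_le {q : ℕ} {l : ℝ}
    (hl : |l| ≤ 2 * Real.sqrt q / ((q : ℝ) + 1)) :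
    (q : ℝ) ^ (1 - pexp q l) = Real.sqrt q := by
  rw [pexp, if_pos hl, Real.sqrt_eq_rpow]
  norm_num

theorem two_mul_sqrt_lt_of_not_le {q : ℕ} {l : ℝ}
    (hl : ¬ |l| ≤ 2 * Real.sqrt q / ((q : ℝ) + 1)) :
    2 * Real.sqrt q < ((q : ℝ) + 1) * |l| := by
  have h : (0 : ℝ) < (q : ℝ) + 1 := by positivity
  rw [not_le, div_lt_iff₀ h] at hl
  linarith

theorem rpow_one_sub_pexp_of_not_le {q : ℕ} (hq : 2 ≤ q) {l : ℝ}
    (hl : ¬ |l| ≤ 2 * Real.sqrt q / ((q : ℝ) + 1)) :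
    (q : ℝ) ^ (1 - pexp q l) =
      (((q : ℝ) + 1) * |l| + Real.sqrt (((q : ℝ) + 1) ^ 2 * l ^ 2 - 4 * q)) / 2 := by
  have hq' : (2 : ℝ) ≤ q := by exact_mod_cast hq
  have h := two_mul_sqrt_lt_of_not_le hl
  have h2 : 0 < Real.sqrt q := Real.sqrt_pos.2 (by linarith)
  rw [pexp, if_neg hl, sub_sub_cancel, Real.rpow_logb (by linarith) (by linarith)]
  have := Real.sqrt_nonneg (((q : ℝ) + 1) ^ 2 * l ^ 2 - 4 * q)
  linarith

theorem sqrt_le_rpow_one_sub_pexp {q : ℕ} (hq : 2 ≤ q) (l : ℝ) :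
    Real.sqrt q ≤ (q : ℝ) ^ (1 - pexp q l) := by
  by_cases hl : |l| ≤ 2 * Real.sqrt q / ((q : ℝ) + 1)
  · rw [rpow_one_sub_pexp_of_le hl]
  · rw [rpow_one_sub_pexp_of_not_le hq hl]
    have := Real.sqrt_nonneg (((q : ℝ) + 1) ^ 2 * l ^ 2 - 4 * q)
    linarith [two_mul_sqrt_lt_of_not_le hl]

theorem pexp_le_half {q : ℕ} (hq : 2 ≤ q) (l : ℝ) : pexp q l ≤ 1 / 2 := by
  have hq' : (1 : ℝ) < q := by exact_mod_cast hq
  have h := sqrt_le_rpow_one_sub_pexp hq l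
  rw [Real.sqrt_eq_rpow, Real.rpow_le_rpow_left_iff hq'] at h
  linarith

theorem pexp_nonneg {q : ℕ} (hq : 2 ≤ q) {l : ℝ} (hl : |l| ≤ 1) : 0 ≤ pexp q l := by
  have hq' : (1 : ℝ) < q := by exact_mod_cast hq
  by_cases h : |l| ≤ 2 * Real.sqrt q / ((q : ℝ) + 1)
  · rw [pexp, if_pos h]
    norm_num
  · have hle : (q : ℝ) ^ (1 - pexp q l) ≤ (q : ℝ) ^ (1 : ℝ) := by
      rw [rpow_one_sub_pexp_of_not_le hq h, Real.rpow_one]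
      have hs : Real.sqrt (((q : ℝ) + 1) ^ 2 * l ^ 2 - 4 * q) ≤ q - 1 := by
        rw [Real.sqrt_le_left (by linarith)]
        have : l ^ 2 ≤ 1 := (sq_le_one_iff_abs_le_one l).2 hl
        nlinarith [sq_nonneg ((q : ℝ) + 1)]
      nlinarith
    rw [Real.rpow_le_rpow_left_iff hq'] at hle
    linarith

theorem exists_add_mul_eq_norm_le {q : ℕ} (hq : 2 ≤ q) (l : ℝ) :
    ∃ α β : ℂ, α + β = ((((q : ℝ) + 1) * l : ℝ) : ℂ) ∧ α * β = q ∧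
      ‖α‖ ≤ (q : ℝ) ^ (1 - pexp q l) ∧ ‖β‖ ≤ (q : ℝ) ^ (1 - pexp q l) := by
  have hqn : (0 : ℝ) ≤ q := Nat.cast_nonneg q
  set μ : ℝ := ((q : ℝ) + 1) * l with hμ
  have habs : |μ| = ((q : ℝ) + 1) * |l| := by rw [hμ, abs_mul, abs_of_pos (by positivity)]
  by_cases hl : |l| ≤ 2 * Real.sqrt q / ((q : ℝ) + 1)
  · have hle : |μ| ≤ 2 * Real.sqrt q := by
      rw [habs]
      rw [le_div_iff₀ (by positivity)] at hl
      linarith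
    have hsq : μ ^ 2 ≤ 4 * q := by
      have := sq_le_sq' (neg_le_of_abs_le hle) (le_of_abs_le hle)
      rw [mul_pow 2, Real.sq_sqrt hqn] at this
      linarith
    set s : ℝ := Real.sqrt (4 * q - μ ^ 2) with hs
    have hs2 : s ^ 2 = 4 * q - μ ^ 2 := Real.sq_sqrt (by linarith)
    rw [rpow_one_sub_pexp_of_le hl]
    refine ⟨⟨μ / 2, s / 2⟩, ⟨μ / 2, -(s / 2)⟩, ?_, ?_, ?_, ?_⟩
    · apply Complex.ext <;> simp
    · apply Complex.ext
      · simp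
        linarith
      · simp
        ring
    · rw [Complex.norm_def, Complex.normSq_mk]
      exact Real.sqrt_le_sqrt (by linarith)
    · rw [Complex.norm_def, Complex.normSq_mk]
      exact Real.sqrt_le_sqrt (by linarith)
  · have hlt := two_mul_sqrt_lt_of_not_le hl
    have hsq : 4 * q ≤ μ ^ 2 := by
      rw [← sq_abs μ, habs]
      have := pow_le_pow_left₀ (by positivity) hlt.le 2
      rw [mul_pow, Real.sq_sqrt hqn] at this
      linarith
    set s : ℝ := Real.sqrt (μ ^ 2 - 4 * q) with hs
    have hs0 : 0 ≤ s := Real.sqrt_nonneg _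
    have hs2 : s ^ 2 = μ ^ 2 - 4 * q := Real.sq_sqrt (by linarith)
    rw [rpow_one_sub_pexp_of_not_le hq hl, ← mul_pow, ← hμ, ← habs, ← hs]
    have h1 := abs_add_le μ s
    have h2 := abs_sub μ s
    rw [abs_of_nonneg hs0] at h1 h2
    refine ⟨((μ + s) / 2 : ℝ), ((μ - s) / 2 : ℝ), ?_, ?_, ?_, ?_⟩
    · rw [← Complex.ofReal_add]
      congr 1
      ring
    · rw [← Complex.ofReal_mul, ← Complex.ofReal_natCast]
      congr 1
      linarith
    · rw [Complex.norm_real, Real.norm_eq_abs, abs_div, abs_two]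
      linarith
    · rw [Complex.norm_real, Real.norm_eq_abs, abs_div, abs_two]
      linarith

theorem PX_le_sum_rpow {V ι : Type*} [Fintype V] [Fintype ι] {G : SimpleGraph V} {q : ℕ}
    (hq : 2 ≤ q) (hreg : G.IsRegularOfDegree (q + 1)) {l : ι → ℝ}
    (hl : (G.adjMatrix ℝ).charpoly =
      ∏ i, (Polynomial.X - Polynomial.C (((q : ℝ) + 1) * l i))) {k : ℕ} (hk : 1 ≤ k) :
    (PX G k : ℝ) ≤ 2 * (k + 1) * ∑ i, (q : ℝ) ^ ((k : ℝ) * (1 - pexp q (l i))) := by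
  obtain ⟨k, rfl⟩ := Nat.exists_eq_add_of_le' hk
  have hq' : (1 : ℝ) ≤ q := by exact_mod_cast le_trans (by norm_num) hq
  rw [PX_eq_trace, nbMatrix_succ_eq_aeval hreg,
    trace_aeval_eq_sum_of_charpoly (G.isHermitian_adjMatrix ℝ) hl, Finset.mul_sum]
  refine Finset.sum_le_sum fun i _ => (le_abs_self _).trans ?_
  obtain ⟨α, β, hadd, hmul, hα, hβ⟩ := exists_add_mul_eq_norm_le hq (l i)
  refine (abs_eval_nbPoly_le ?_ hadd hmul hα hβ k).trans (le_of_eq ?_)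
  · refine le_trans ?_ (sqrt_le_rpow_one_sub_pexp hq (l i))
    rwa [Real.one_le_sqrt]
  · rw [mul_comm ((k + 1 : ℕ) : ℝ), Real.rpow_mul (by linarith), Real.rpow_natCast]
    push_cast
    ring

theorem sum_rpow_le_sum_card_mul_rpow {ι : Type*} [Fintype ι] {b K : ℝ} (hb : 1 ≤ b)
    (hK : 0 ≤ K) {x : ι → ℝ} (hx0 : ∀ i, 0 ≤ x i) (hx1 : ∀ i, x i ≤ 1 / 2) {N : ℕ} (hN : 0 < N) :
    ∑ i, b ^ (K * (1 - x i)) ≤ ∑ j ∈ Finset.range N,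
      ((Finset.univ.filter fun i => x i ≤ ((j : ℝ) + 1) / (2 * N)).card : ℝ) *
        b ^ (K * (1 - j / (2 * N))) := by
  have hN' : (0 : ℝ) < 2 * N := by positivity
  have hcard : ∀ j : ℕ,
      ((Finset.univ.filter fun i => x i ≤ ((j : ℝ) + 1) / (2 * N)).card : ℝ) *
        b ^ (K * (1 - j / (2 * N))) =
      ∑ i, if x i ≤ ((j : ℝ) + 1) / (2 * N) then b ^ (K * (1 - j / (2 * N))) else 0 := by
    intro j
    rw [← Finset.sum_filter, Finset.sum_const, nsmul_eq_mul]
  simp_rw [hcard]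
  rw [Finset.sum_comm]
  refine Finset.sum_le_sum fun i _ => ?_
  have hfloor : ∃ j ∈ Finset.range N, (j : ℝ) / (2 * N) ≤ x i ∧ x i ≤ ((j : ℝ) + 1) / (2 * N) := by
    simp_rw [div_le_iff₀ hN', le_div_iff₀ hN', Finset.mem_range]
    have hy0 : 0 ≤ x i * (2 * N) := mul_nonneg (hx0 i) hN'.le
    have hy1 : x i * (2 * N) ≤ N := by nlinarith [hx1 i]
    by_cases h : ⌊x i * (2 * N)⌋₊ < N
    · exact ⟨_, h, Nat.floor_le hy0, (Nat.lt_floor_add_one _).le⟩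
    · refine ⟨N - 1, by omega, ?_, ?_⟩
      · have h2 : (N : ℝ) ≤ x i * (2 * N) := (Nat.le_floor_iff hy0).1 (not_lt.1 h)
        exact le_trans (by exact_mod_cast Nat.sub_le N 1) h2
      · rw [Nat.cast_sub hN]
        simpa using hy1
  obtain ⟨j, hj, hlo, hhi⟩ := hfloor
  have hnonneg : ∀ j ∈ Finset.range N,
      0 ≤ if x i ≤ ((j : ℝ) + 1) / (2 * N) then b ^ (K * (1 - j / (2 * N))) else 0 := by
    intro j _
    split_ifs <;> positivity
  refine le_trans ?_ (Finset.single_le_sum hnonneg hj)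
  rw [if_pos hhi]
  exact Real.rpow_le_rpow_of_exponent_le hb (by gcongr)

theorem two_mul_add_one_le_rpow {q : ℝ} (hq : 1 < q) {B δ : ℝ} (hB : 0 ≤ B) (hδ : 0 < δ) {n k : ℝ}
    (hn : 1 ≤ n) (hk : k ≤ B * Real.logb q n) :
    2 * (k + 1) ≤ 2 * (B / (Real.log q * δ) + 1) * n ^ δ := by
  have hlogq : 0 < Real.log q := Real.log_pos hq
  have hlog : Real.logb q n ≤ n ^ δ / (Real.log q * δ) := by
    rw [Real.logb, mul_comm, ← div_div]
    gcongr
    exact Real.log_le_rpow_div (by linarith) hδ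
  have hone : 1 ≤ n ^ δ := Real.one_le_rpow hn hδ.le
  have hmul : B * Real.logb q n ≤ B * (n ^ δ / (Real.log q * δ)) := by gcongr
  have heq : B * (n ^ δ / (Real.log q * δ)) = B / (Real.log q * δ) * n ^ δ := by ring
  linarith

theorem rpow_mul_one_sub_le {q : ℝ} (hq : 1 < q) {A n k t : ℝ} (hn : 1 ≤ n)
    (hk : k ≤ 2 * A * Real.logb q n) (ht : t ≤ 1 / 2) :
    q ^ (k * (1 - t)) ≤ n ^ (A * (1 - 2 * t)) * q ^ (k / 2) := by
  have hq0 : 0 < q := by linarith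
  have hsplit : k * (1 - t) = k * (1 / 2 - t) + k / 2 := by ring
  rw [hsplit, Real.rpow_add hq0]
  gcongr
  have hn' : n = q ^ Real.logb q n := (Real.rpow_logb hq0 hq.ne' (by linarith)).symm
  conv_rhs => rw [hn', ← Real.rpow_mul hq0.le]
  refine Real.rpow_le_rpow_of_exponent_le hq.le ?_
  nlinarith [mul_le_mul_of_nonneg_right hk (sub_nonneg.2 ht)]

/-- The Sarnak–Xue density property with parameter `A` implies the weak
injective radius property: `P(X,k) ≪_ε n^{1+ε} q^{k/2}` for `k ≤ 2A log_q n`. -/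
theorem stmt9 (q : ℕ) (hq : 2 ≤ q) (A : ℝ) (hA0 : 0 < A) (hA1 : A ≤ 1)
    (V : ℕ → Type) [∀ m, Fintype (V m)] [∀ m, Nonempty (V m)]
    (G : ∀ m, SimpleGraph (V m))
    (hreg : ∀ m, (G m).IsRegularOfDegree (q + 1))
    (lam : ∀ m, Fin (Fintype.card (V m)) → ℝ)
    (hev : ∀ m, ((G m).adjMatrix ℝ).charpoly =
      ∏ i, (Polynomial.X - Polynomial.C (((q : ℝ) + 1) * lam m i)))
    (hdensity : ∀ p : ℝ, 2 < p → ∀ ε : ℝ, 0 < ε → ∃ C : ℝ, 0 < C ∧ ∀ m,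
      ((Finset.univ.filter (fun i => pexp q (lam m i) ≤ 1 / p)).card : ℝ)
        ≤ C * (Fintype.card (V m) : ℝ) ^ (1 - A * (1 - 2 / p) + ε)) :
    ∀ ε : ℝ, 0 < ε → ∃ C : ℝ, 0 < C ∧ ∀ m, ∀ k : ℕ, 1 ≤ k →
      (k : ℝ) ≤ 2 * A * Real.logb q (Fintype.card (V m)) →
      (PX (G m) k : ℝ)
        ≤ C * (Fintype.card (V m) : ℝ) ^ (1 + ε) * (q : ℝ) ^ ((k : ℝ) / 2) := by
  intro ε hε
  set δ : ℝ := ε / 3 with hδ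
  have hδ0 : 0 < δ := by positivity
  have hq' : (1 : ℝ) < q := by exact_mod_cast hq
  obtain ⟨N, hN⟩ := exists_nat_gt (1 / δ)
  have hNpos : 0 < N := by
    have : (0 : ℝ) < N := lt_trans (by positivity) hN
    exact_mod_cast this
  have hNR : (0 : ℝ) < N := by exact_mod_cast hNpos
  have hAN : A / N ≤ δ := by
    rw [div_lt_iff₀ hδ0] at hN
    rw [div_le_iff₀ hNR]
    linarith
  have hcount : ∀ j : ℕ, ∃ C : ℝ, 0 < C ∧ ∀ m,
      ((Finset.univ.filter fun i => pexp q (lam m i) ≤ ((j : ℝ) + 1) / (2 * N)).card : ℝ)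
        ≤ C * (Fintype.card (V m) : ℝ) ^ (1 - A * (1 - 2 * (((j : ℝ) + 1) / (2 * N))) + δ) := by
    intro j
    have hj : (0 : ℝ) < (j : ℝ) + 1 := by positivity
    rcases lt_or_ge (j + 1) N with h | h
    · have h' : (j : ℝ) + 1 < N := by exact_mod_cast h
      obtain ⟨C, hC, hCm⟩ := hdensity (2 * N / ((j : ℝ) + 1))
        (by rw [lt_div_iff₀ hj]; linarith) δ hδ0
      refine ⟨C, hC, fun m => ?_⟩
      have h1 : 1 / (2 * N / ((j : ℝ) + 1)) = ((j : ℝ) + 1) / (2 * N) := one_div_div _ _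
      have h2 : 2 / (2 * N / ((j : ℝ) + 1)) = 2 * (((j : ℝ) + 1) / (2 * N)) := by
        rw [← h1]
        ring
      have := hCm m
      rwa [h1, h2] at this
    · refine ⟨1, one_pos, fun m => ?_⟩
      have h' : (N : ℝ) ≤ (j : ℝ) + 1 := by exact_mod_cast h
      have hn : (1 : ℝ) ≤ Fintype.card (V m) := by exact_mod_cast Fintype.card_pos
      have ht : 1 / 2 ≤ ((j : ℝ) + 1) / (2 * N) := by
        rw [div_le_div_iff₀ two_pos (by positivity)]
        linarith
      rw [one_mul]
      calc _ ≤ (Fintype.card (V m) : ℝ) := by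
            exact_mod_cast (Finset.card_le_univ _).trans (by simp)
        _ = (Fintype.card (V m) : ℝ) ^ (1 : ℝ) := (Real.rpow_one _).symm
        _ ≤ _ := Real.rpow_le_rpow_of_exponent_le hn (by nlinarith)
  choose C hC hCm using hcount
  have hlogq : 0 < Real.log q := Real.log_pos hq'
  set D : ℝ := 2 * (2 * A / (Real.log q * δ) + 1) with hD
  have hD0 : 0 < D := by positivity
  have hCsum : 0 < ∑ j ∈ Finset.range N, C j :=
    Finset.sum_pos (fun j _ => hC j) (Finset.nonempty_range_iff.2 hNpos.ne')
  refine ⟨D * ∑ j ∈ Finset.range N, C j, by positivity, fun m k hk1 hk => ?_⟩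
  set n : ℝ := (Fintype.card (V m) : ℝ) with hndef
  have hn : 1 ≤ n := Nat.one_le_cast.2 Fintype.card_pos
  have hn0 : 0 < n := by linarith
  have hlam : ∀ i, |lam m i| ≤ 1 := by
    intro i
    have h := abs_le_of_charpoly_adjMatrix (hreg m) (hev m) i
    have hpos : (0 : ℝ) < (q : ℝ) + 1 := by positivity
    rw [abs_mul, abs_of_pos hpos] at h
    push_cast at h
    exact le_of_mul_le_mul_left (by linarith) hpos
  have hterm : ∀ j ∈ Finset.range N,
      ((Finset.univ.filter fun i => pexp q (lam m i) ≤ ((j : ℝ) + 1) / (2 * N)).card : ℝ) *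
        (q : ℝ) ^ ((k : ℝ) * (1 - j / (2 * N))) ≤
      C j * (n ^ (1 + 2 * δ) * (q : ℝ) ^ ((k : ℝ) / 2)) := by
    intro j hj
    have hj' : (j : ℝ) ≤ N := by exact_mod_cast (Finset.mem_range.1 hj).le
    have ht : (j : ℝ) / (2 * N) ≤ 1 / 2 := by
      rw [div_le_div_iff₀ (by positivity) two_pos]
      linarith
    calc _ ≤ C j * n ^ (1 - A * (1 - 2 * (((j : ℝ) + 1) / (2 * N))) + δ) *
          (n ^ (A * (1 - 2 * (j / (2 * N)))) * (q : ℝ) ^ ((k : ℝ) / 2)) :=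
          mul_le_mul (hCm j m) (rpow_mul_one_sub_le hq' hn hk ht) (by positivity)
            (mul_nonneg (hC j).le (by positivity))
      _ = C j * (n ^ (1 + A / N + δ) * (q : ℝ) ^ ((k : ℝ) / 2)) := by
          have hexp : 1 + A / N + δ = (1 - A * (1 - 2 * (((j : ℝ) + 1) / (2 * N))) + δ) +
              A * (1 - 2 * (j / (2 * N))) := by
            field_simp
            ring
          rw [hexp, Real.rpow_add hn0 _ (A * (1 - 2 * (j / (2 * N))))]
          ring
      _ ≤ _ := mul_le_mul_of_nonneg_left (mul_le_mul_of_nonneg_right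
          (Real.rpow_le_rpow_of_exponent_le hn (by linarith)) (by positivity)) (hC j).le
  have hsum := sum_rpow_le_sum_card_mul_rpow hq'.le (Nat.cast_nonneg k)
    (fun i => pexp_nonneg hq (hlam i)) (fun i => pexp_le_half hq (lam m i)) hNpos
  calc (PX (G m) k : ℝ)
      ≤ 2 * (k + 1) * ∑ i, (q : ℝ) ^ ((k : ℝ) * (1 - pexp q (lam m i))) :=
        PX_le_sum_rpow hq (hreg m) (hev m) hk1
    _ ≤ D * n ^ δ * ∑ j ∈ Finset.range N, C j * (n ^ (1 + 2 * δ) * (q : ℝ) ^ ((k : ℝ) / 2)) :=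
        mul_le_mul (two_mul_add_one_le_rpow hq' (by positivity) hδ0 hn hk)
          (hsum.trans (Finset.sum_le_sum hterm))
          (Finset.sum_nonneg fun i _ => by positivity) (by positivity)
    _ = D * (∑ j ∈ Finset.range N, C j) * n ^ (1 + ε) * (q : ℝ) ^ ((k : ℝ) / 2) := by
        have hexp : 1 + ε = δ + (1 + 2 * δ) := by
          rw [hδ]
          ring
        rw [← Finset.sum_mul, hexp, Real.rpow_add hn0 δ]
        ring
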